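/- Let q ≥ 81 be an even power of an odd prime (so q is a square). Then f(2q + √q) = q + √q + 2 and f(2q − √q) = q + √q. -/

import Mathlib

open scoped BigOperators

/-- Points (and, by self-duality of homogeneous coordinates, lines) of the
Desarguesian projective plane `PG(2,q)` over the field `F`. -/
abbrev PG (F : Type*) [Field F] := Projectivization F (Fin 3 → F)

/-- Incidence between a point and a line (the line being given by its dual
homogeneous coordinates): the dot product of representatives vanishes.
This does not depend on the choice of representatives. -/
def Incid {F : Type*} [Field F] (p l : PG F) : Prop :=
  ∑ i, p.rep i * l.rep i = 0

/-- `𝒫ᵒ(R)`: points incident with an odd number of lines of `R`. -/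
def Podd (F : Type*) [Field F] (R : Set (PG F)) : Set (PG F) :=
  {p | Odd {l ∈ R | Incid p l}.ncard}

/-- `𝒫ᵉ(R)`: points incident with an even number of lines of `R`. -/
def Peven (F : Type*) [Field F] (R : Set (PG F)) : Set (PG F) :=
  {p | Even {l ∈ R | Incid p l}.ncard}

/-- `ℒᵒ(S)`: lines meeting `S` in an odd number of points. -/
def Lodd (F : Type*) [Field F] (S : Set (PG F)) : Set (PG F) :=
  {l | Odd {p ∈ S | Incid p l}.ncard}

/-- `ℒᵉ(S)`: lines meeting `S` in an even number of points. -/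
def Leven (F : Type*) [Field F] (S : Set (PG F)) : Set (PG F) :=
  {l | Even {p ∈ S | Incid p l}.ncard}

/-- `f(r)`: the minimum size of the symmetric difference of `r` distinct lines,
i.e. the minimum of `|𝒫ᵒ(R)|` over sets `R` of exactly `r` lines. -/
noncomputable def fmin (F : Type*) [Field F] (r : ℕ) : ℕ :=
  sInf {n | ∃ R : Set (PG F), R.ncard = r ∧ (Podd F R).ncard = n}

open Finset

/-- Abstract self-dual projective plane of order `q`. -/
structure Pl {X : Type*} [Fintype X] [DecidableEq X] (I : X → X → Prop) [DecidableRel I]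
    (q : ℕ) : Prop where
  symm : ∀ a b, I a b → I b a
  deg : ∀ a, #{l | I a l} = q + 1
  meet : ∀ a b, a ≠ b → #{l | I a l ∧ I b l} = 1
  card : Fintype.card X = q ^ 2 + q + 1

section abs
variable {X : Type*} [Fintype X] [DecidableEq X] {I : X → X → Prop} [DecidableRel I] {q : ℕ}

def ix (I : X → X → Prop) [DecidableRel I] (S : Finset X) (l : X) : ℕ := #{p ∈ S | I p l}

def od (I : X → X → Prop) [DecidableRel I] (S : Finset X) : Finset X := {l | Odd (ix I S l)}

def CB (I : X → X → Prop) (Z : Finset X) (r : ℕ) : Prop :=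
  ∀ n ∈ Z, ∀ Q : Finset X, (∀ P ∈ Q, ¬ I P n) → (∀ l ∈ Z, l ≠ n → ∃ P ∈ Q, I P l) → r < #Q

theorem ix_pencil (h : Pl I q) (S : Finset X) (p : X) :
    ∑ l with I p l, ix I S l = #S + if p ∈ S then q else 0 := by
  have e : ∑ l with I p l, ix I S l = ∑ a ∈ S, #{l | I p l ∧ I a l} := by
    simp only [ix, card_filter, sum_filter]
    rw [sum_congr rfl (fun l _ => by
      show _ = ∑ a ∈ S, (if I p l ∧ I a l then 1 else 0)
      split_ifs with hl <;> simp [hl]), sum_comm]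
  rw [e]
  have : ∀ a ∈ S, #{l | I p l ∧ I a l} = 1 + if p = a then q else 0 := by
    intro a _
    split_ifs with hpa
    · subst hpa; simp [h.deg, add_comm]
    · simpa using h.meet _ _ hpa
  rw [sum_congr rfl this, sum_add_distrib]
  simp

theorem ix_sum (h : Pl I q) (S : Finset X) : ∑ l, ix I S l = #S * (q + 1) := by
  simp only [ix, card_filter]
  rw [sum_comm]
  simp [h.deg]

theorem ix_sum_sq (h : Pl I q) (S : Finset X) : ∑ l, ix I S l ^ 2 = #S * (q + #S) := by
  have e : ∑ l, ix I S l ^ 2 = ∑ p ∈ S, ∑ l with I p l, ix I S l := by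
    simp only [sum_filter]
    rw [sum_comm]
    refine sum_congr rfl fun l _ => ?_
    rw [← sum_filter, sum_const, sq]
    rfl
  rw [e, sum_congr rfl (fun p hp => by rw [ix_pencil h, if_pos hp]), sum_const]
  simp [add_comm]

theorem mem_od {S : Finset X} {l : X} : l ∈ od I S ↔ Odd (ix I S l) := by simp [od]

theorem mem_od_od (h : Pl I q) (S : Finset X) (p : X) :
    p ∈ od I (od I S) ↔ Odd (#S + if p ∈ S then q else 0) := by
  rw [← ix_pencil h, mem_od, odd_sum_iff_odd_card_odd]
  have : ({l ∈ (univ.filter (I p)) | Odd (ix I S l)} : Finset X) = {l ∈ od I S | I l p} := by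
    ext l
    simp [od]
    have := h.symm l p
    have := h.symm p l
    tauto
  rw [this]; rfl

theorem od_od_even (h : Pl I q) (hq : Odd q) (S : Finset X) (hS : Even #S) :
    od I (od I S) = S := by
  ext p
  rw [mem_od_od h]
  split_ifs with hp
  · simp [hp, hS.add_odd hq]
  · simp [hp, hS]

theorem od_od_odd (h : Pl I q) (hq : Odd q) (S : Finset X) (hS : Odd #S) :
    od I (od I S) = Sᶜ := by
  ext p
  rw [mem_od_od h]
  split_ifs with hp
  · simp [hp, hS.add_odd hq]
  · simp [hp, hS]

theorem even_card_od (h : Pl I q) (hq : Odd q) (S : Finset X) : Even #(od I S) := by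
  have h1 := ix_sum h S
  rw [← Nat.not_odd_iff_even]
  intro ho
  have : Odd (∑ l, ix I S l) := by
    rw [odd_sum_iff_odd_card_odd]; exact ho
  rw [h1] at this
  exact Nat.not_even_iff_odd.2 this ((hq.add_one).mul_left _)

theorem od_symmDiff (S T : Finset X) : od I (symmDiff S T) = symmDiff (od I S) (od I T) := by
  ext l
  have : ix I (symmDiff S T) l + 2 * #{p ∈ S ∩ T | I p l} = ix I S l + ix I T l := by
    simp only [ix, card_filter]
    rw [show (symmDiff S T) = (S ∪ T) \ (S ∩ T) from by
      ext x; simp [mem_symmDiff]; tauto]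
    have h1 := sum_sdiff (f := fun p => if I p l then 1 else 0)
      (show S ∩ T ⊆ S ∪ T from fun x hx => by simp at hx ⊢; tauto)
    have h2 := sum_union_inter (f := fun p => if I p l then 1 else 0) (s₁ := S) (s₂ := T)
    omega
  rw [mem_symmDiff]
  simp only [mem_od, Nat.odd_iff]
  omega

theorem od_compl (h : Pl I q) (hq : Odd q) (S : Finset X) : od I Sᶜ = od I S := by
  ext l
  have : ix I S l + ix I Sᶜ l = q + 1 := by
    rw [← h.deg l]
    simp only [ix]
    rw [← card_union_of_disjoint]
    · congr 1
      ext p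
      simp only [mem_union, mem_filter, mem_compl, mem_univ, true_and]
      have := h.symm p l
      have := h.symm l p
      tauto
    · exact disjoint_filter_filter disjoint_compl_right
  rw [mem_od, mem_od, Nat.odd_iff, Nat.odd_iff]
  rw [Nat.odd_iff] at hq
  omega

theorem ix_moment (h : Pl I q) (S : Finset X) :
    ∑ l, (ix I S l : ℤ) * (2 - ix I S l) = #S * (q + 2 - #S) := by
  have h1 : (∑ l, (ix I S l : ℤ)) = #S * (q + 1) := by exact_mod_cast ix_sum h S
  have h2 : (∑ l, (ix I S l : ℤ) ^ 2) = #S * (q + #S) := by exact_mod_cast ix_sum_sq h S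
  have : ∀ l, (ix I S l : ℤ) * (2 - ix I S l) = 2 * ix I S l - (ix I S l : ℤ) ^ 2 :=
    fun l => by ring
  simp only [this, sum_sub_distrib, ← mul_sum, h1, h2]
  ring

theorem card_od_ge (h : Pl I q) (S : Finset X) : (#S * (q + 2 - #S) : ℤ) ≤ #(od I S) := by
  rw [← ix_moment h, od, card_filter]
  push_cast
  refine sum_le_sum fun l _ => ?_
  split_ifs with ho
  · nlinarith [sq_nonneg ((ix I S l : ℤ) - 1)]
  · have : ix I S l = 0 ∨ 2 ≤ ix I S l := by
      rcases Nat.eq_zero_or_pos (ix I S l) with h0 | h0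
      · exact Or.inl h0
      · right
        by_contra hh
        exact ho (by rw [show ix I S l = 1 by omega]; exact odd_one)
    rcases this with h0 | h0
    · simp [h0]
    · have : (2 : ℤ) ≤ ix I S l := by exact_mod_cast h0
      nlinarith

theorem card_od_pair (h : Pl I q) (S : Finset X) (hS : #S = 2) : #(od I S) = 2 * q := by
  have := ix_moment h S
  have e : (#(od I S) : ℤ) = ∑ l, (ix I S l : ℤ) * (2 - ix I S l) := by
    rw [od, card_filter]
    push_cast
    refine sum_congr rfl fun l _ => ?_
    have : ix I S l ≤ 2 := hS ▸ card_filter_le _ _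
    interval_cases hx : ix I S l <;> norm_num
  rw [this, hS] at e
  push_cast at e
  have : (#(od I S) : ℤ) = 2 * q := by rw [e]; ring
  exact_mod_cast this

/-! Covering lemmas -/

theorem CB.peel {Z : Finset X} {r : ℕ} (h : CB I Z (r + 1)) (A : X) :
    CB I {l ∈ Z | ¬ I A l} r := by
  intro n hn Q h1 h2
  rw [mem_filter] at hn
  have := h n hn.1 (insert A Q) (by
    intro P hP
    rcases mem_insert.1 hP with rfl | hP
    · exact hn.2
    · exact h1 P hP) (by
    intro l hl hln
    by_cases hA : I A l
    · exact ⟨A, mem_insert_self _ _, hA⟩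
    · obtain ⟨P, hP, hPl⟩ := h2 l (mem_filter.2 ⟨hl, hA⟩) hln
      exact ⟨P, mem_insert_of_mem hP, hPl⟩)
  have := card_insert_le A Q
  omega

theorem exists_on_two (h : Pl I q) (l n : X) : ∃ P, I P l ∧ I P n := by
  by_cases hl : l = n
  · subst hl
    have := h.deg l
    have : 0 < #{x | I l x} := by omega
    obtain ⟨P, hP⟩ := card_pos.1 this
    simp at hP
    exact ⟨P, h.symm _ _ hP, h.symm _ _ hP⟩
  · have := h.meet l n hl
    obtain ⟨P, hP⟩ := card_pos.1 (this ▸ one_pos)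
    simp at hP
    exact ⟨P, h.symm _ _ hP.1, h.symm _ _ hP.2⟩

theorem exists_on_off (h : Pl I q) (hq : 1 ≤ q) {l n : X} (hl : l ≠ n) : ∃ P, I P l ∧ ¬ I P n := by
  by_contra! hc
  have h1 := h.meet l n hl
  have h2 := h.deg l
  have : #{x | I l x} ≤ #{x | I l x ∧ I n x} := by
    refine card_le_card fun x hx => ?_
    simp at hx ⊢
    exact ⟨hx, h.symm _ _ (hc x (h.symm _ _ hx))⟩
  omega

theorem CB.card_ge (hp : Pl I q) (hq : 1 ≤ q) {Z : Finset X} {r : ℕ} (h : CB I Z r)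
    (hZ : Z.Nonempty) : r + 2 ≤ #Z := by
  obtain ⟨n, hn⟩ := hZ
  have : ∀ l, ∃ P, l ≠ n → (I P l ∧ ¬ I P n) := fun l => by
    by_cases hl : l = n
    · exact ⟨n, fun h => absurd hl h⟩
    · obtain ⟨P, hP⟩ := exists_on_off hp hq hl
      exact ⟨P, fun _ => hP⟩
  choose f hf using this
  have h1 := h n hn ((Z.erase n).image f) (by
    intro P hP
    obtain ⟨l, hl, rfl⟩ := mem_image.1 hP
    exact (hf l (ne_of_mem_erase hl)).2) (by
    intro l hl hln
    exact ⟨f l, mem_image_of_mem _ (mem_erase.2 ⟨hln, hl⟩), (hf l hln).1⟩)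
  have h2 : #((Z.erase n).image f) ≤ #(Z.erase n) := card_image_le
  have h3 := card_erase_add_one hn
  omega

theorem exists_max (Z : Finset X) [Nonempty X] :
    ∃ A, ∀ B, #{l ∈ Z | I B l} ≤ #{l ∈ Z | I A l} := by
  obtain ⟨A, -, hA⟩ := exists_max_image (univ : Finset X) (fun A => #{l ∈ Z | I A l}) univ_nonempty
  exact ⟨A, fun B => hA B (mem_univ _)⟩

theorem CB.one_point (hp : Pl I q) (hq : 1 ≤ q) [Nonempty X] {r : ℕ} : ∀ {Z : Finset X},
    CB I Z r → #Z ≤ 2 * r + 1 → ∃ A, ∀ l ∈ Z, I A l := by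
  induction r with
  | zero =>
    intro Z _ hZ
    rcases Z.eq_empty_or_nonempty with rfl | ⟨n, hn⟩
    · exact ⟨Classical.arbitrary X, by simp⟩
    · obtain ⟨P, hP⟩ := exists_on_two hp n n
      refine ⟨P, fun l hl => ?_⟩
      rw [card_le_one.1 (by omega) l hl n hn]
      exact hP.1
  | succ r ih =>
    intro Z h hZ
    rcases Nat.lt_or_ge 1 #Z with h1 | h1
    · obtain ⟨A, hA⟩ := exists_max (I := I) Z
      have hA2 : 2 ≤ #{l ∈ Z | I A l} := by
        obtain ⟨l, hl, n, hn, hln⟩ := one_lt_card.1 h1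
        obtain ⟨P, hP1, hP2⟩ := exists_on_two hp l n
        refine le_trans ?_ (hA P)
        rw [← card_pair hln]
        refine card_le_card fun x hx => ?_
        simp at hx ⊢
        rcases hx with rfl | rfl <;> tauto
      have hsplit := card_filter_add_card_filter_not (s := Z) (fun l => I A l)
      have hc := h.peel A
      obtain ⟨B, hB⟩ := ih hc (by omega)
      by_cases hE : ({l ∈ Z | ¬ I A l} : Finset X).Nonempty
      · have h3 := hc.card_ge hp hq hE
        have h4 : #{l ∈ Z | ¬ I A l} ≤ #{l ∈ Z | I B l} := by
          refine card_le_card fun x hx => ?_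
          have := hB x hx
          simp at hx ⊢
          tauto
        have := hA B
        omega
      · refine ⟨A, fun l hl => ?_⟩
        by_contra hn
        exact hE ⟨l, by simp [hl, hn]⟩
    · rcases Z.eq_empty_or_nonempty with rfl | ⟨n, hn⟩
      · exact ⟨Classical.arbitrary X, by simp⟩
      · obtain ⟨P, hP⟩ := exists_on_two hp n n
        refine ⟨P, fun l hl => ?_⟩
        rw [card_le_one.1 (by omega) l hl n hn]
        exact hP.1

theorem arc_card (hp : Pl I q) (Z : Finset X) (h : ∀ A, #{l ∈ Z | I A l} ≤ 2) : #Z ≤ q + 2 := by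
  rcases Z.eq_empty_or_nonempty with rfl | ⟨n, hn⟩
  · simp
  have : ∀ l, ∃ P, I P l ∧ I P n := fun l => exists_on_two hp l n
  choose f hf using this
  have h1 : #(Z.erase n) ≤ #{P | I n P} := by
    refine card_le_card_of_injOn f (fun l _ => by simpa using hp.symm _ _ (hf l).2) ?_
    intro a ha b hb hab
    by_contra hne
    have h3 : #{n, a, b} ≤ #{l ∈ Z | I (f a) l} := by
      refine card_le_card fun x hx => ?_
      have hb' := hab ▸ (hf b).1
      simp at hx ha hb ⊢
      rcases hx with rfl | rfl | rfl
      · exact ⟨hn, (hf _).2⟩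
      · exact ⟨ha.1, (hf _).1⟩
      · exact ⟨hb.1, hb'⟩
    have h4 : #{n, a, b} = 3 := by
      rw [card_eq_three]
      simp at ha hb
      exact ⟨n, a, b, Ne.symm ha.2, Ne.symm hb.2, hne, rfl⟩
    have := h (f a)
    omega
  have h3 := card_erase_add_one hn
  rw [hp.deg] at h1
  omega

theorem CB.two_points (hp : Pl I q) (hq : 5 ≤ q) [Nonempty X] {C r : ℕ} (hC : q ≤ 2 * C + 3) :
    ∀ {Z : Finset X}, CB I Z r → #Z + C ≤ 3 * r →
    ∃ A B, ∀ l ∈ Z, I A l ∨ I B l := by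
  induction r with
  | zero =>
    intro Z _ hZ
    have : Z = ∅ := card_eq_zero.1 (by omega)
    subst this
    exact ⟨Classical.arbitrary X, Classical.arbitrary X, by simp⟩
  | succ r ih =>
    intro Z h hZ
    rcases Nat.lt_or_ge (2 * (r + 1) + 1) #Z with h1 | h1
    · obtain ⟨A, hA⟩ := exists_max (I := I) Z
      have hA3 : 3 ≤ #{l ∈ Z | I A l} := by
        by_contra hlt
        have := arc_card hp Z (fun B => by have := hA B; omega)
        omega
      have hsplit := card_filter_add_card_filter_not (s := Z) (fun l => I A l)
      have hc := h.peel A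
      obtain ⟨B, D, hBD⟩ := ih hc (by omega)
      set Z' : Finset X := {l ∈ Z | ¬ I A l} with hZ'
      by_cases hE1 : ({l ∈ Z' | ¬ I B l} : Finset X).Nonempty
      · by_cases hE2 : ({l ∈ Z' | ¬ I D l} : Finset X).Nonempty
        · exfalso
          obtain ⟨r, rfl⟩ : ∃ r', r = r' + 1 := ⟨r - 1, by omega⟩
          have hB := (hc.peel B).card_ge hp (by omega) hE1
          have hD := (hc.peel D).card_ge hp (by omega) hE2
          have hs := card_filter_add_card_filter_not (s := Z') (fun l => I B l)
          have h4 : #{l ∈ Z' | ¬ I D l} ≤ #{l ∈ Z' | I B l} := by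
            refine card_le_card fun x hx => ?_
            rw [mem_filter] at hx ⊢
            have := hBD x hx.1
            tauto
          have h5 : #{l ∈ Z' | I B l} ≤ #{l ∈ Z | I B l} :=
            card_le_card (filter_subset_filter _ (filter_subset _ _))
          have := hA B
          omega
        · refine ⟨A, D, fun l hl => ?_⟩
          by_contra! hn
          exact hE2 ⟨l, by simp [hZ', hl, hn]⟩
      · refine ⟨A, B, fun l hl => ?_⟩
        by_contra! hn
        exact hE1 ⟨l, by simp [hZ', hl, hn]⟩
    · obtain ⟨A, hA⟩ := h.one_point hp (by omega) h1
      exact ⟨A, A, fun l hl => Or.inl (hA l hl)⟩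
end abs

section abs2
variable {X : Type*} [Fintype X] [DecidableEq X] {I : X → X → Prop} [DecidableRel I] {q : ℕ}

theorem card_symmDiff_add (S T : Finset X) : #(symmDiff S T) + 2 * #(S ∩ T) = #S + #T := by
  rw [show (symmDiff S T) = (S ∪ T) \ (S ∩ T) from by
      ext x; simp [mem_symmDiff]; tauto]
  have h1 := card_sdiff_add_card_eq_card
      (show S ∩ T ⊆ S ∪ T from fun x hx => by simp at hx ⊢; tauto)
  have h2 := card_union_add_card_inter S T
  omega

theorem bruen_sum (h : Pl I q) (T : Finset X) (κ : ℤ) (hT : (#T : ℤ) = q + 1 + κ) :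
    ∑ l, ((ix I T l : ℤ) - 1) * (ix I T l - κ - 1) = q * (q - κ ^ 2) := by
  have h1 : (∑ l, (ix I T l : ℤ)) = #T * (q + 1) := by exact_mod_cast ix_sum h T
  have h2 : (∑ l, (ix I T l : ℤ) ^ 2) = #T * (q + #T) := by exact_mod_cast ix_sum_sq h T
  have : ∀ l, ((ix I T l : ℤ) - 1) * (ix I T l - κ - 1) =
      (ix I T l : ℤ) ^ 2 - (κ + 2) * ix I T l + (κ + 1) :=
    fun l => by ring
  simp only [this, sum_sub_distrib, sum_add_distrib, ← mul_sum, h1, h2, hT, sum_const, card_univ,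
    h.card]
  push_cast
  ring

theorem ix_add_le (h : Pl I q) (T : Finset X) (hb : ∀ l, 1 ≤ ix I T l) (l P : X) (hP : I P l)
    (hPT : P ∉ T) : ix I T l + q ≤ #T := by
  have h1 := ix_pencil h T P
  rw [if_neg hPT, add_zero] at h1
  have hm : l ∈ ({l | I P l} : Finset X) := by simpa using hP
  rw [← add_sum_erase _ _ hm] at h1
  have h2 : #(({l | I P l} : Finset X).erase l) • 1 ≤
      ∑ x ∈ ({l | I P l} : Finset X).erase l, ix I T x :=
    card_nsmul_le_sum _ _ _ (fun x _ => hb x)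
  rw [card_erase_of_mem hm, h.deg] at h2
  simp at h2
  omega

theorem bruen (h : Pl I q) {m : ℕ} (hm : q = m ^ 2) (hm0 : 1 ≤ m) (T : Finset X)
    (hb : ∀ l, 1 ≤ ix I T l) (hn : ∀ l, ∃ P, I P l ∧ P ∉ T) (hT : #T ≤ q + m + 1) :
    #T = q + m + 1 ∧ ∀ l, ix I T l = 1 ∨ ix I T l = m + 1 := by
  have hle : ∀ l, ix I T l + q ≤ #T := fun l => by
    obtain ⟨P, h1, h2⟩ := hn l
    exact ix_add_le h T hb l P h1 h2
  have hpos : 0 < Fintype.card X := by rw [h.card]; omega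
  obtain ⟨l0⟩ := Fintype.card_pos_iff.1 hpos
  obtain ⟨k, hk⟩ : ∃ k, #T = q + 1 + k := ⟨#T - (q + 1), by have := hle l0; have := hb l0; omega⟩
  have hs := bruen_sum h T k (by rw [hk]; push_cast; ring)
  have hterm : ∀ l ∈ (univ : Finset X), ((ix I T l : ℤ) - 1) * (ix I T l - k - 1) ≤ 0 := by
    intro l _
    have h1 := hb l
    have h2 := hle l
    have h3 : (0 : ℤ) ≤ (ix I T l : ℤ) - 1 := by omega
    have h4 : (ix I T l : ℤ) - k - 1 ≤ 0 := by omega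
    exact mul_nonpos_of_nonneg_of_nonpos h3 h4
  have hsn := sum_nonpos hterm
  have hkm : k = m := by
    by_contra hne
    have hlt : k + 1 ≤ m := by omega
    have : (0 : ℤ) < q * (q - k ^ 2) := by
      have h1 : (k : ℤ) + 1 ≤ m := by exact_mod_cast hlt
      have h2 : (q : ℤ) = m ^ 2 := by exact_mod_cast hm
      have h0 : (0 : ℤ) ≤ k := by positivity
      have hqp : (0 : ℤ) < q := by rw [h2]; nlinarith
      apply mul_pos hqp
      nlinarith
    omega
  subst hkm
  refine ⟨by omega, fun l => ?_⟩
  have h0 : ∑ l, ((ix I T l : ℤ) - 1) * (ix I T l - k - 1) = 0 := by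
    rw [hs, hm]; push_cast; ring
  have := (sum_eq_zero_iff_of_nonpos hterm).1 h0 l (mem_univ _)
  rcases mul_eq_zero.1 this with h1 | h1
  · left; omega
  · right; omega

theorem baer_count (h : Pl I q) {m : ℕ} (hm : q = m ^ 2) (hm0 : 1 ≤ m) (hmo : Odd m)
    (T : Finset X) (hT : #T = q + m + 1) (hix : ∀ l, ix I T l = 1 ∨ ix I T l = m + 1) (A : X) :
    #(od I (symmDiff T {A}))ᶜ = if A ∈ T then 2 * q - m else 2 * q + m := by
  have hsum : ∀ L : Finset X, ∑ l ∈ L, ix I T l = #L + m * #{l ∈ L | ix I T l ≠ 1} := by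
    intro L
    rw [card_filter, mul_sum, card_eq_sum_ones, ← sum_add_distrib]
    refine sum_congr rfl fun l _ => ?_
    rcases hix l with h1 | h1
    · simp [h1]
    · have : m ≠ 0 := by omega
      simp [h1, this, add_comm]
  have hodT : od I T = ({l | ix I T l = 1} : Finset X) := by
    ext l
    rw [mem_od, mem_filter]
    rcases hix l with h1 | h1
    · simp [h1]
    · have : m ≠ 0 := by omega
      have h3 : ¬ Odd (m + 1) := Nat.not_odd_iff_even.2 hmo.add_one
      simp [h1, this, h3]
  have hodA : od I {A} = ({l | I A l} : Finset X) := by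
    ext l
    rw [mem_od, mem_filter, ix, filter_singleton]
    by_cases hA : I A l <;> simp [hA]
  have ht := hsum univ
  rw [ix_sum h, hT, card_univ, h.card] at ht
  have hs1 := card_filter_add_card_filter_not (s := (univ : Finset X)) (fun l => ix I T l = 1)
  rw [card_univ, h.card] at hs1
  have hA1 := hsum {l | I A l}
  rw [ix_pencil h, hT, h.deg] at hA1
  have hs2 := card_filter_add_card_filter_not (s := ({l | I A l} : Finset X))
    (fun l => ix I T l = 1)
  rw [h.deg] at hs2
  have ha : #{l | ix I T l ≠ 1} = q + m + 1 := by
    have : m * #{l | ix I T l ≠ 1} = m * (q + m + 1) := by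
      subst hm
      nlinarith
    exact Nat.eq_of_mul_eq_mul_left hm0 this
  have hsd := card_symmDiff_add (od I T) (od I {A})
  rw [od_symmDiff, card_compl, h.card]
  have hinter : od I T ∩ od I {A} = {l ∈ ({l | I A l} : Finset X) | ix I T l = 1} := by
    rw [hodT, hodA]; ext l; simp [and_comm]
  rw [hinter, hodT, hodA, h.deg] at hsd
  rw [hodT, hodA]
  have hmq : m ≤ q := by rw [hm]; nlinarith
  simp only [ne_eq] at ha hA1
  split_ifs with hAT
  · rw [if_pos hAT] at hA1
    have : #{l ∈ ({l | I A l} : Finset X) | ¬ ix I T l = 1} = m + 1 := by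
      have : m * #{l ∈ ({l | I A l} : Finset X) | ¬ ix I T l = 1} = m * (m + 1) := by
        subst hm
        nlinarith
      exact Nat.eq_of_mul_eq_mul_left hm0 this
    omega
  · rw [if_neg hAT] at hA1
    have : #{l ∈ ({l | I A l} : Finset X) | ¬ ix I T l = 1} = 1 := by
      have : m * #{l ∈ ({l | I A l} : Finset X) | ¬ ix I T l = 1} = m * 1 := by
        omega
      exact Nat.eq_of_mul_eq_mul_left hm0 this
    omega

theorem CB.mono {Z : Finset X} {r r' : ℕ} (h : CB I Z r) (hr : r' ≤ r) : CB I Z r' :=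
  fun n hn Q h1 h2 => lt_of_le_of_lt hr (h n hn Q h1 h2)

/-- The case in which a set of lines nearly contains a full line. -/
theorem lower_line (h : Pl I q) (hq : Odd q) {m : ℕ} (hm : q = m ^ 2) (hm9 : 9 ≤ m)
    (R : Finset X) (hRo : Odd #R) (hR1 : 2 * q ≤ #R + m) (hR2 : #R ≤ 2 * q + m)
    (hR3 : #R ≠ 2 * q + 1) (hR4 : #R + 1 ≠ 2 * q)
    (hS : #(od I R) ≤ q + m) (l : X) (hl : q ≤ ix I (od I R) l) : False := by
  set S := od I R with hSdef
  have h9 : 9 * m ≤ q := by rw [hm]; nlinarith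
  have hpl : od I {l} = ({p | I p l} : Finset X) := by
    ext p
    rw [mem_od, mem_filter, ix, filter_singleton]
    have := h.symm p l
    have := h.symm l p
    by_cases hA : I l p <;> simp [hA] <;> tauto
  have hplc : #(od I {l}) = q + 1 := by
    rw [← h.deg l, hpl]
    congr 1
    ext p
    have := h.symm p l
    have := h.symm l p
    simp; tauto
  have hodU : od I (symmDiff S (od I {l})) = symmDiff R {l} := by
    rw [od_symmDiff, hSdef, od_od_odd h hq R hRo, od_od_odd h hq {l} (by simp)]
    ext x; simp [mem_symmDiff]
  have hU := card_symmDiff_add S (od I {l})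
  have hinter : S ∩ od I {l} = {p ∈ S | I p l} := by
    rw [hpl]; ext x; simp
  rw [hinter, hplc] at hU
  have hix : #{p ∈ S | I p l} = ix I S l := rfl
  rw [hix] at hU
  have hV := card_symmDiff_add R {l}
  have hV2 : #(R ∩ {l}) ≤ 1 := (card_le_card inter_subset_right).trans (by simp)
  rw [card_singleton] at hV
  have hge := card_od_ge h (symmDiff S (od I {l}))
  set u := #(symmDiff S (od I {l})) with hu
  have hue : Even u := by
    have h1 : Even #S := even_card_od h hq R
    have h2 : Even (q + 1) := hq.add_one
    rw [Nat.even_iff] at *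
    omega
  rw [hodU] at hge
  have hum : u ≤ m + 1 := by omega
  have : u = 0 ∨ u = 2 ∨ 4 ≤ u := by
    rw [Nat.even_iff] at hue; omega
  rcases this with h0 | h2 | h4
  · have := card_eq_zero.1 (hu.symm.trans h0)
    rw [this] at hodU
    have : od I (∅ : Finset X) = ∅ := by ext x; simp [mem_od, ix]
    rw [this] at hodU
    rw [← hodU] at hV
    simp at hV
    omega
  · have := card_od_pair h _ (hu.symm.trans h2)
    rw [hodU] at this
    omega
  · have h5 : (4 * (q - 2) : ℤ) ≤ u * (q + 2 - u) := by
      have h6 : (4 : ℤ) ≤ u := by exact_mod_cast h4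
      have h7 : (u : ℤ) ≤ q - 2 := by omega
      nlinarith
    omega

theorem lower_two (h : Pl I q) (hq : Odd q) {m : ℕ} (hm : q = m ^ 2) (hm9 : 9 ≤ m)
    (R Z : Finset X) (hR1 : 2 * q ≤ #R + m) (hR2 : #R ≤ 2 * q + m)
    (hR3 : #R ≠ 2 * q + 1) (hR4 : #R + 1 ≠ 2 * q) (hR5 : #R ≠ 2 * q)
    (hS : #(od I R) ≤ q + m) (hZR : Z ⊆ R) (A B : X) (hAB : ∀ l ∈ Z, I A l ∨ I B l)
    (hA : q ≤ #{l ∈ Z | ¬ I A l} + m + 1) (hB : q ≤ #{l ∈ Z | ¬ I B l} + m + 1) : False := by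
  have h9 : 9 * m ≤ q := by rw [hm]; nlinarith
  have hne : A ≠ B := by
    rintro rfl
    have : #{l ∈ Z | ¬ I A l} = 0 := by
      rw [card_eq_zero, filter_eq_empty_iff]
      intro l hl
      have := hAB l hl
      tauto
    omega
  have hp2 : #({A, B} : Finset X) = 2 := card_pair hne
  have hD := card_od_pair h _ hp2
  have hDD := od_od_even h hq {A, B} (by rw [hp2]; exact even_two)
  have hU := card_symmDiff_add R (od I {A, B})
  have hV := card_symmDiff_add (od I R) {A, B}
  have hodU : od I (symmDiff R (od I {A, B})) = symmDiff (od I R) {A, B} := by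
    rw [od_symmDiff, hDD]
  have hge := card_od_ge h (symmDiff R (od I {A, B}))
  rw [hodU] at hge
  have hlow : #{l ∈ Z | ¬ I A l} + #{l ∈ Z | ¬ I B l} ≤ #(R ∩ od I {A, B}) := by
    rw [← card_union_of_disjoint]
    · refine card_le_card fun l hl => ?_
      rw [mem_inter, mem_od]
      simp only [mem_union, mem_filter] at hl
      have hlZ : l ∈ Z := by tauto
      refine ⟨hZR hlZ, ?_⟩
      have := hAB l hlZ
      rw [ix, filter_insert, filter_singleton]
      by_cases h1 : I A l <;> by_cases h2 : I B l <;> simp [h1, h2] <;> tauto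
    · rw [disjoint_left]
      intro l h1 h2
      rw [mem_filter] at h1 h2
      have := hAB l h1.1
      tauto
  set u := #(symmDiff R (od I {A, B})) with hu
  have hub : u ≤ q := by omega
  have : u ≤ 1 ∨ 2 ≤ u := by omega
  have hRD : #R + 2 * #(od I {A, B} \ R) = u + 2 * q := by
    have h3 := card_sdiff_add_card_inter (od I {A, B}) R
    rw [inter_comm] at h3
    omega
  have hRD2 : #(od I {A, B} \ R) ≤ u := by
    refine card_le_card fun x hx => ?_
    rw [mem_sdiff] at hx
    rw [mem_symmDiff]; tauto
  rcases this with h0 | h2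
  · omega
  · have h5 : (2 * q : ℤ) ≤ u * (q + 2 - u) := by
      have h6 : (2 : ℤ) ≤ u := by exact_mod_cast h2
      have h7 : (u : ℤ) ≤ q := by exact_mod_cast hub
      have h8 := mul_nonneg (sub_nonneg.2 h6) (sub_nonneg.2 h7)
      linarith
    omega

theorem lower (h : Pl I q) (hq : Odd q) {m : ℕ} (hm : q = m ^ 2) (hm9 : 9 ≤ m)
    (hCB : ∀ S : Finset X, S.Nonempty → #S ≤ q + m →
      CB I {l | ix I S l = 0} (2 * q - 2 - #S))
    (R : Finset X) (hR : #R = 2 * q + m ∨ #R = 2 * q - m ∧ #(od I R) < q + m)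
    (hS : #(od I R) ≤ q + m) : False := by
  have h9 : 9 * m ≤ q := by rw [hm]; nlinarith
  have hmo : Odd m := by
    rw [hm] at hq
    exact Nat.Odd.of_mul_left (by rwa [sq] at hq)
  have hRo : Odd #R := by
    rw [Nat.odd_iff] at *
    omega
  have hR1 : 2 * q ≤ #R + m := by omega
  have hR2 : #R ≤ 2 * q + m := by omega
  have hSR : od I (od I R) = Rᶜ := od_od_odd h hq R hRo
  set S := od I R with hSdef
  have hSne : S.Nonempty := by
    rw [nonempty_iff_ne_empty]
    intro h0
    rw [h0] at hSR
    have : od I (∅ : Finset X) = ∅ := by ext x; simp [mem_od, ix]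
    rw [this] at hSR
    have h1 := card_compl R
    rw [← hSR, h.card] at h1
    simp at h1
    have : 9 * q ≤ q ^ 2 := by nlinarith
    omega
  set Z : Finset X := {l | ix I S l = 0} with hZ
  have hZR : Z ⊆ R := by
    intro l hl
    by_contra hn
    have : l ∈ od I S := by rw [hSR]; simpa using hn
    rw [mem_od] at this
    simp [hZ] at hl
    rw [hl] at this
    simp at this
  have hcb : CB I Z (q - m - 2) := (hCB S hSne hS).mono (by omega)
  have : Nonempty X := ⟨hSne.choose⟩
  have hq8 : 8 * m + 9 ≤ q := by rw [hm]; nlinarith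
  have hZc := card_le_card hZR
  obtain ⟨C, hC⟩ : ∃ C, q = 2 * C + 3 := by
    obtain ⟨c, hc⟩ := hq
    exact ⟨c - 1, by omega⟩
  obtain ⟨A, B, hAB⟩ := hcb.two_points h (by omega) (C := C) (by omega) (by omega)
  have hone : ∃ A, ∀ l ∈ Z, I A l := by
    have hcb' : CB I Z (q - m - 3 + 1) := hcb.mono (by omega)
    by_contra! hno
    have hge : ∀ P, q ≤ #{l ∈ Z | ¬ I P l} + m + 1 := by
      intro P
      obtain ⟨l, hl, hPl⟩ := hno P
      have := (hcb'.peel P).card_ge h (by omega) ⟨l, by simp [hl, hPl]⟩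
      omega
    exact lower_two h hq hm hm9 R Z hR1 hR2 (by omega) (by omega) (by omega) hS hZR A B hAB
      (hge A) (hge B)
  clear hAB
  obtain ⟨A, hA⟩ := hone
  have hline : ∀ l, ¬ q ≤ ix I S l := fun l hl =>
    lower_line h hq hm hm9 R hRo hR1 hR2 (by omega) (by omega) hS l hl
  have hT : ∀ l, ix I (insert A S) l ≤ ix I S l + 1 := by
    intro l
    rw [ix, filter_insert]
    split_ifs
    · exact card_insert_le _ _
    · exact Nat.le_succ _
  have hTb : ∀ l, 1 ≤ ix I (insert A S) l := by
    intro l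
    by_cases hl : ix I S l = 0
    · have := hA l (by simp [hZ, hl])
      exact card_pos.2 ⟨A, by simp [this]⟩
    · have : ix I S l ≤ ix I (insert A S) l :=
        card_le_card (filter_subset_filter _ (subset_insert _ _))
      omega
  have hTn : ∀ l, ∃ P, I P l ∧ P ∉ insert A S := by
    intro l
    by_contra! hc
    have h1 : #{P | I l P} ≤ ix I (insert A S) l := by
      refine card_le_card fun P hP => ?_
      simp only [mem_filter, mem_univ, true_and] at hP ⊢
      exact ⟨hc P (h.symm _ _ hP), h.symm _ _ hP⟩
    rw [h.deg] at h1
    have := hT l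
    exact hline l (by omega)
  have hTc := card_insert_le A S
  obtain ⟨hc, hix⟩ := bruen h hm (by omega) (insert A S) hTb hTn (by omega)
  have hAS : A ∉ S := by
    intro hmem
    rw [insert_eq_of_mem hmem] at hc
    omega
  have hcount := baer_count h hm (by omega) hmo (insert A S) hc hix A
  have : symmDiff (insert A S) {A} = S := by
    ext x
    rw [mem_symmDiff, mem_insert, mem_singleton]
    by_cases hx : x = A
    · subst hx; simp [hAS]
    · simp [hx]
  rw [this, hSR, if_pos (mem_insert_self _ _), compl_compl] at hcount
  omega

theorem upper (h : Pl I q) (hq : Odd q) {m : ℕ} (hm : q = m ^ 2) (hm0 : 1 ≤ m)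
    (T : Finset X) (hT : #T = q + m + 1) (hb : ∀ l, 1 ≤ ix I T l)
    (hn : ∀ l, ∃ P, I P l ∧ P ∉ T) :
    (∃ R : Finset X, #R = 2 * q + m ∧ #(od I R) = q + m + 2) ∧
    (∃ R : Finset X, #R = 2 * q - m ∧ #(od I R) = q + m) := by
  have hmo : Odd m := by
    have hq' := hq
    rw [hm] at hq'
    exact Nat.Odd.of_mul_left (by rwa [sq] at hq')
  obtain ⟨-, hix⟩ := bruen h hm hm0 T hb hn hT.le
  have key : ∀ A, od I (od I (symmDiff T {A}))ᶜ = symmDiff T {A} := by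
    intro A
    rw [od_compl h hq, od_od_even h hq]
    have := card_symmDiff_add T {A}
    rw [card_singleton] at this
    rw [Nat.odd_iff] at hq hmo
    rw [Nat.even_iff]
    omega
  have hpos : 0 < Fintype.card X := by rw [h.card]; omega
  obtain ⟨l0⟩ := Fintype.card_pos_iff.1 hpos
  obtain ⟨P, -, hP⟩ := hn l0
  obtain ⟨Q, hQ⟩ : T.Nonempty := card_pos.1 (by omega)
  constructor
  · refine ⟨(od I (symmDiff T {P}))ᶜ, ?_, ?_⟩
    · rw [baer_count h hm hm0 hmo T hT hix, if_neg hP]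
    · rw [key]
      have := card_symmDiff_add T {P}
      rw [inter_singleton_of_notMem hP] at this
      simp at this
      omega
  · refine ⟨(od I (symmDiff T {Q}))ᶜ, ?_, ?_⟩
    · rw [baer_count h hm hm0 hmo T hT hix, if_pos hQ]
    · rw [key]
      have := card_symmDiff_add T {Q}
      rw [inter_singleton_of_mem hQ] at this
      simp at this
      omega
end abs2

section conc
open Classical Projectivization
open scoped Matrix

variable {F : Type*} [Field F]

theorem incid_iff_orth (p l : PG F) : Incid p l ↔ p.orthogonal l := by
  conv_rhs => rw [← p.mk_rep, ← l.mk_rep, orthogonal_mk]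
  rfl

theorem incid_mk (v : Fin 3 → F) (hv : v ≠ 0) (l : PG F) :
    Incid (mk F v hv) l ↔ ∑ i, v i * l.rep i = 0 := by
  rw [incid_iff_orth]
  conv_lhs => rw [← l.mk_rep, orthogonal_mk]
  rfl

theorem incid_symm (p l : PG F) : Incid p l ↔ Incid l p := by
  rw [incid_iff_orth, incid_iff_orth, orthogonal_comm]

theorem pg_card [Fintype F] [Fintype (PG F)] :
    Fintype.card (PG F) = Fintype.card F ^ 2 + Fintype.card F + 1 := by
  have := Projectivization.card_of_finrank (k := F) (V := Fin 3 → F) (n := 3) (by simp)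
  rw [Nat.card_eq_fintype_card, Nat.card_eq_fintype_card] at this
  rw [this]
  simp [sum_range_succ]
  ring

theorem pg_pl [Fintype F] [Fintype (PG F)] : Pl (Incid (F := F)) (Fintype.card F) where
  symm a b h := (incid_symm _ _).1 h
  card := pg_card
  meet a b hab := by
    rw [card_eq_one]
    obtain ⟨l, hl, hu⟩ := Configuration.HasLines.existsUnique_line (PG F) (PG F) a b hab
    refine ⟨l, ?_⟩
    ext x
    simp only [mem_filter, mem_univ, true_and, mem_singleton, incid_iff_orth]
    constructor
    · intro hx
      exact hu x hx
    · rintro rfl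
      exact hl
  deg a := by
    have h1 := Configuration.ProjectivePlane.card_points (PG F) (PG F)
    rw [pg_card] at h1
    have h2 : Configuration.ProjectivePlane.order (PG F) (PG F) = Fintype.card F := by
      nlinarith
    have h3 := Configuration.ProjectivePlane.lineCount_eq (P := PG F) (PG F) a
    rw [h2] at h3
    rw [← h3, Configuration.lineCount, Nat.card_eq_fintype_card, Fintype.card_subtype]
    congr 1
    ext x
    simp only [mem_filter, mem_univ, true_and, incid_iff_orth]
    rfl

/-- The linear form attached to a point. -/
noncomputable def lf (P : PG F) : MvPolynomial (Fin 3) F :=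
  ∑ i, MvPolynomial.C (P.rep i) * MvPolynomial.X i

theorem lf_eval (P : PG F) (v : Fin 3 → F) :
    MvPolynomial.eval v (lf P) = ∑ i, P.rep i * v i := by
  simp [lf]

theorem lf_deg (P : PG F) : (lf P).totalDegree ≤ 1 := by
  refine MvPolynomial.totalDegree_finsetSum_le fun i _ => ?_
  refine (MvPolynomial.totalDegree_mul _ _).trans ?_
  simp [MvPolynomial.totalDegree_X]

theorem lf_prod_deg (S : Finset (PG F)) : (∏ P ∈ S, lf P).totalDegree ≤ #S := by
  refine (MvPolynomial.totalDegree_finsetProd _ _).trans ?_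
  refine (sum_le_sum fun P _ => lf_deg P).trans ?_
  simp

theorem pg_CB [Fintype F] [Fintype (PG F)] (S : Finset (PG F)) (hS : S.Nonempty)
    (hSc : #S ≤ 2 * Fintype.card F - 2) :
    CB (Incid (F := F)) {l | ix Incid S l = 0} (2 * Fintype.card F - 2 - #S) := by
  intro n hn Q h1 h2
  by_contra hlt
  rw [not_lt] at hlt
  obtain ⟨O, hO⟩ := hS
  have hq : 1 < Fintype.card F := Fintype.one_lt_card
  have hnS : ∀ P ∈ S, ¬ Incid P n := by
    intro P hP hPn
    simp only [mem_filter, mem_univ, true_and, ix, card_eq_zero, filter_eq_empty_iff] at hn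
    exact hn hP hPn
  set q := Fintype.card F with hqd
  set G : MvPolynomial (Fin 3) F :=
    (∏ P ∈ S.erase O, lf P) * (∏ P ∈ Q, lf P) * (1 - (lf O - 1) ^ (q - 1)) with hG
  have hdeg : G.totalDegree < (q - 1) * Fintype.card (Fin 3) := by
    have a1 := lf_prod_deg (S.erase O)
    have a2 := lf_prod_deg Q
    have a3 : (1 - (lf O - 1) ^ (q - 1)).totalDegree ≤ q - 1 := by
      refine (MvPolynomial.totalDegree_sub _ _).trans ?_
      simp only [MvPolynomial.totalDegree_one, max_le_iff, zero_le, true_and]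
      refine (MvPolynomial.totalDegree_pow _ _).trans ?_
      have : (lf O - 1).totalDegree ≤ 1 := by
        refine (MvPolynomial.totalDegree_sub _ _).trans ?_
        simp [lf_deg]
      nlinarith
    have a4 := MvPolynomial.totalDegree_mul
      ((∏ P ∈ S.erase O, lf P) * (∏ P ∈ Q, lf P)) (1 - (lf O - 1) ^ (q - 1))
    have a5 := MvPolynomial.totalDegree_mul (∏ P ∈ S.erase O, lf P) (∏ P ∈ Q, lf P)
    have a6 := card_erase_add_one hO
    rw [Fintype.card_fin, hG]
    omega
  have hsum := MvPolynomial.sum_eval_eq_zero G hdeg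
  have hev : ∀ v, MvPolynomial.eval v G = (∏ P ∈ S.erase O, ∑ i, P.rep i * v i) *
      (∏ P ∈ Q, ∑ i, P.rep i * v i) * (1 - ((∑ i, O.rep i * v i) - 1) ^ (q - 1)) := by
    intro v
    simp [hG, lf_eval]
  set c : F := (∑ i, O.rep i * n.rep i)⁻¹ with hc
  have hOn : (∑ i, O.rep i * n.rep i) ≠ 0 := hnS O hO
  have hscal : ∀ (P : PG F) (a : F) (w : Fin 3 → F),
      ∑ i, P.rep i * (a • w) i = a * ∑ i, P.rep i * w i := by
    intro P a w
    rw [mul_sum]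
    refine sum_congr rfl fun i _ => ?_
    simp; ring
  rw [Fintype.sum_eq_single (c • n.rep)] at hsum
  · rw [hev] at hsum
    have hlast : (1 - ((∑ i, O.rep i * (c • n.rep) i) - 1) ^ (q - 1)) = (1 : F) := by
      rw [hscal, hc, inv_mul_cancel₀ hOn, sub_self, zero_pow (by omega), sub_zero]
    rw [hlast, mul_one] at hsum
    have hc0 : c ≠ 0 := inv_ne_zero hOn
    rcases mul_eq_zero.1 hsum with h | h
    · obtain ⟨P, hP, h0⟩ := prod_eq_zero_iff.1 h
      rw [hscal] at h0
      exact hnS P (mem_of_mem_erase hP) ((mul_eq_zero.1 h0).resolve_left hc0)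
    · obtain ⟨P, hP, h0⟩ := prod_eq_zero_iff.1 h
      rw [hscal] at h0
      exact h1 P hP ((mul_eq_zero.1 h0).resolve_left hc0)
  · intro v hv
    rw [hev]
    by_cases hOv : (∑ i, O.rep i * v i) = 1
    · have hv0 : v ≠ 0 := by
        rintro rfl
        simp at hOv
      have hinc : ∀ P : PG F, Incid P (mk F v hv0) ↔ ∑ i, P.rep i * v i = 0 := by
        intro P
        rw [incid_symm, incid_mk]
        simp only [mul_comm]
      have hln : mk F v hv0 ≠ n := by
        intro hl
        rw [← n.mk_rep, mk_eq_mk_iff'] at hl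
        obtain ⟨a, ha⟩ := hl
        apply hv
        rw [← ha]
        congr 1
        rw [← ha, hscal] at hOv
        rw [hc]
        exact eq_inv_of_mul_eq_one_left hOv
      by_cases hZ : ix Incid S (mk F v hv0) = 0
      · obtain ⟨P, hP, hPl⟩ := h2 (mk F v hv0) (by simp [hZ]) hln
        rw [prod_eq_zero hP ((hinc P).1 hPl)]
        simp
      · obtain ⟨P, hP⟩ := card_pos.1 (Nat.pos_of_ne_zero hZ)
        rw [mem_filter, hinc] at hP
        have hPO : P ≠ O := by
          rintro rfl
          rw [hP.2] at hOv
          exact zero_ne_one hOv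
        rw [prod_eq_zero (mem_erase.2 ⟨hPO, hP.1⟩) hP.2]
        simp
    · have : ((∑ i, O.rep i * v i) - 1) ^ (q - 1) = 1 :=
        FiniteField.pow_card_sub_one_eq_one _ (sub_ne_zero.2 hOv)
      rw [this]
      simp


theorem exists_subfield [Fintype F] (m : ℕ) (hm : Fintype.card F = m ^ 2) :
    ∃ (p k : ℕ) (_ : Fact p.Prime) (_ : GaloisField p k →+* F), k ≠ 0 ∧ p ^ k = m := by
  obtain ⟨p, hp⟩ := CharP.exists F
  obtain ⟨n, hpp, hn⟩ := FiniteField.card F p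
  have : Fact p.Prime := ⟨hpp⟩
  obtain ⟨k, -, hk⟩ := (Nat.dvd_prime_pow hpp).1 (show m ∣ p ^ (n : ℕ) by
    rw [← hn, hm]; exact dvd_pow_self m two_ne_zero)
  have hnk : (n : ℕ) = k * 2 := by
    rw [hm, hk, ← pow_mul] at hn
    exact (Nat.pow_right_injective hpp.two_le hn).symm
  have hk0 : k ≠ 0 := by
    have := n.pos
    omega
  let alg : Algebra (ZMod p) F := ZMod.algebra F p
  have hf : Module.finrank (ZMod p) F = n := by
    have := FiniteField.pow_finrank_eq_card p F
    rw [hn] at this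
    exact Nat.pow_right_injective hpp.two_le this
  obtain ⟨f⟩ := FiniteField.nonempty_algHom_of_finrank_dvd (F := ZMod p) (K := GaloisField p k)
    (L := F) (by rw [GaloisField.finrank p hk0, hf, hnk]; exact Dvd.intro _ rfl)
  exact ⟨p, k, this, f.toRingHom, hk0, hk.symm⟩

theorem comp_ne_zero {K : Type*} [Field K] (f : K →+* F) {v : Fin 3 → K} (hv : v ≠ 0) :
    (fun j => f (v j)) ≠ 0 := by
  intro h
  apply hv
  ext j
  have := congrFun h j
  simpa using this

noncomputable def bmap {K : Type*} [Field K] (f : K →+* F) (p : PG K) : PG F :=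
  mk F (fun j => f (p.rep j)) (comp_ne_zero f p.rep_nonzero)

theorem bmap_inj {K : Type*} [Field K] (f : K →+* F) : Function.Injective (bmap f) := by
  intro p p' h
  rw [bmap, bmap, mk_eq_mk_iff'] at h
  obtain ⟨a, ha⟩ := h
  rw [← p.mk_rep, ← p'.mk_rep, mk_eq_mk_iff']
  obtain ⟨j, hj⟩ := Function.ne_iff.1 p'.rep_nonzero
  have hj' : f (p'.rep j) ≠ 0 := by simpa using hj
  have haj : a * f (p'.rep j) = f (p.rep j) := congrFun ha j
  have ha2 : a = f (p.rep j / p'.rep j) := by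
    rw [map_div₀, eq_div_iff hj', haj]
  refine ⟨p.rep j / p'.rep j, ?_⟩
  ext i
  apply f.injective
  have hai : a * f (p'.rep i) = f (p.rep i) := congrFun ha i
  rw [← hai, ha2]
  simp

theorem bmap_ratio {K : Type*} [Field K] (f : K →+* F) (p : PG K) (v : Fin 3 → F) (hv : v ≠ 0)
    (h : bmap f p = mk F v hv) (i j : Fin 3) (hi : v i = 1) : v j ∈ Set.range f := by
  rw [bmap, mk_eq_mk_iff'] at h
  obtain ⟨a, ha⟩ := h
  have h1 : a * v i = f (p.rep i) := congrFun ha i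
  have h2 : a * v j = f (p.rep j) := congrFun ha j
  rw [hi, mul_one] at h1
  have ha0 : a ≠ 0 := by
    rintro rfl
    rw [zero_smul] at ha
    exact comp_ne_zero f p.rep_nonzero ha.symm
  refine ⟨p.rep j / p.rep i, ?_⟩
  rw [map_div₀, ← h1, ← h2]
  field_simp

theorem exists_baer [Fintype F] [Fintype (PG F)] (q m : ℕ) (hq : Fintype.card F = q)
    (hm : q = m ^ 2) (hm2 : 2 ≤ m) :
    ∃ T : Finset (PG F), #T = q + m + 1 ∧ (∀ l, 1 ≤ ix Incid T l) ∧
      ∀ l, ∃ P, Incid P l ∧ P ∉ T := by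
  obtain ⟨p, k, hp, f, hk0, hpk⟩ := exists_subfield (F := F) m (hq.trans hm)
  have : Fintype (GaloisField p k) := Fintype.ofFinite _
  have hK : Fintype.card (GaloisField p k) = m := by
    rw [← Nat.card_eq_fintype_card, GaloisField.card p k hk0, hpk]
  have : Fintype (PG (GaloisField p k)) := Fintype.ofFinite _
  refine ⟨univ.image (bmap f), ?_, ?_, ?_⟩
  · rw [card_image_of_injective _ (bmap_inj f), card_univ, pg_card, hK, hm]
  · intro l
    obtain ⟨v, w, hvw, he⟩ := Fintype.exists_ne_map_eq_of_card_lt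
      (fun v : Fin 3 → GaloisField p k => ∑ i, f (v i) * l.rep i) (by
        rw [Fintype.card_fun, hK, hq, hm, Fintype.card_fin]
        exact Nat.pow_lt_pow_right (by omega) (by omega))
    have hne : v - w ≠ 0 := sub_ne_zero.2 hvw
    refine card_pos.2 ⟨bmap f (mk _ (v - w) hne), ?_⟩
    rw [mem_filter]
    refine ⟨mem_image_of_mem _ (mem_univ _), ?_⟩
    rw [bmap, incid_mk]
    obtain ⟨a, ha⟩ := exists_smul_eq_mk_rep (GaloisField p k) (v - w) hne
    rw [← ha]
    have hx : ∀ i, f ((a • (v - w)) i) * l.rep i =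
        f a * (f (v i) * l.rep i - f (w i) * l.rep i) := by
      intro i
      simp [Units.smul_def]
      ring
    simp only [hx]
    rw [← mul_sum, sum_sub_distrib, he, sub_self, mul_zero]
  · intro l
    obtain ⟨t, ht⟩ : ∃ t, t ∉ Set.range f := by
      by_contra! hc
      have := Fintype.card_le_of_surjective f hc
      rw [hK, hq, hm] at this
      nlinarith
    suffices h : ∃ (v : Fin 3 → F) (i j : Fin 3), v i = 1 ∧ v j = t ∧ ∑ i, v i * l.rep i = 0 by
      obtain ⟨v, i, j, hi, hj, hs⟩ := h
      have hv : v ≠ 0 := by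
        rintro rfl
        simp at hi
      refine ⟨mk F v hv, (incid_mk _ _ _).2 hs, ?_⟩
      intro hmem
      obtain ⟨p', -, hp'⟩ := mem_image.1 hmem
      exact ht (hj ▸ bmap_ratio f p' v hv hp' i j hi)
    by_cases h0 : l.rep 0 = 0
    · by_cases h1 : l.rep 1 = 0
      · have h2 : l.rep 2 ≠ 0 := by
          intro h2
          apply l.rep_nonzero
          ext i
          fin_cases i <;> simp [h0, h1, h2]
        refine ⟨![1, t, 0], 0, 1, by simp, by simp, ?_⟩
        simp [Fin.sum_univ_three, h0, h1]
      · refine ⟨![1, -(t * l.rep 2) / l.rep 1, t], 0, 2, by simp, by simp, ?_⟩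
        simp [Fin.sum_univ_three, h0]
        field_simp
        ring
    · refine ⟨![-(l.rep 1 + t * l.rep 2) / l.rep 0, 1, t], 1, 2, by simp, by simp, ?_⟩
      simp [Fin.sum_univ_three]
      field_simp
      ring

theorem podd_eq [Fintype (PG F)] (R : Finset (PG F)) :
    Podd F (R : Set (PG F)) = (od Incid R : Finset (PG F)) := by
  ext p
  rw [mem_coe, mem_od, Podd, Set.mem_ofPred_eq, ix]
  rw [← Set.ncard_coe_finset]
  congr! 2
  ext l
  simp [incid_symm p l]

theorem fmin_eq [Fintype (PG F)] (r n : ℕ)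
    (hu : ∃ R : Finset (PG F), #R = r ∧ #(od Incid R) = n)
    (hl : ∀ R : Finset (PG F), #R = r → n ≤ #(od Incid R)) : fmin F r = n := by
  apply le_antisymm
  · obtain ⟨R, h1, h2⟩ := hu
    refine Nat.sInf_le ⟨R, ?_, ?_⟩
    · rw [Set.ncard_coe_finset, h1]
    · rw [podd_eq, Set.ncard_coe_finset, h2]
  · obtain ⟨R0, h01, h02⟩ := hu
    refine le_csInf ⟨n, R0, ?_, ?_⟩ ?_
    · rw [Set.ncard_coe_finset, h01]
    · rw [podd_eq, Set.ncard_coe_finset, h02]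
    · rintro b ⟨R, h1, rfl⟩
      have hR : R = ((R.toFinset : Finset (PG F)) : Set (PG F)) := by simp
      rw [hR, Set.ncard_coe_finset] at h1
      rw [hR, podd_eq, Set.ncard_coe_finset]
      exact hl _ h1

end conc

/-- For `q ≥ 81` an even power of an odd prime (so `q = m²` with `m = √q`),
`f(2q + √q) = q + √q + 2` and `f(2q − √q) = q + √q`. -/
theorem stmt19 {F : Type*} [Field F] [Fintype F] (q m : ℕ)
    (hcard : Fintype.card F = q) (hq : Odd q) (hsq : q = m ^ 2) (h81 : 81 ≤ q) :
    fmin F (2 * q + m) = q + m + 2 ∧ fmin F (2 * q - m) = q + m := by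
  classical
  have hm9 : 9 ≤ m := by
    by_contra hlt
    have : m ≤ 8 := by omega
    nlinarith
  have h9 : 9 * m ≤ q := by rw [hsq]; nlinarith
  have : Fintype (PG F) := Fintype.ofFinite _
  have hpl : Pl (Incid (F := F)) q := hcard ▸ pg_pl
  have hCB : ∀ S : Finset (PG F), S.Nonempty → #S ≤ q + m →
      CB Incid {l | ix Incid S l = 0} (2 * q - 2 - #S) := by
    intro S h1 h2
    have := pg_CB S h1 (by rw [hcard]; omega)
    rwa [hcard] at this
  have hmo : Odd m := by
    have hq' := hq
    rw [hsq] at hq'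
    exact Nat.Odd.of_mul_left (by rwa [sq] at hq')
  obtain ⟨T, hT, hb, hn⟩ := exists_baer (F := F) q m hcard hsq (by omega)
  obtain ⟨hu1, hu2⟩ := upper hpl hq hsq (by omega) T hT hb hn
  refine ⟨fmin_eq _ _ hu1 fun R hR => ?_, fmin_eq _ _ hu2 fun R hR => ?_⟩
  · by_contra hlt
    have he := even_card_od hpl hq R
    rw [Nat.even_iff] at he
    rw [Nat.odd_iff] at hq hmo
    exact lower hpl (Nat.odd_iff.2 hq) hsq hm9 hCB R (Or.inl hR) (by omega)
  · by_contra hlt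
    exact lower hpl hq hsq hm9 hCB R (Or.inr ⟨hR, by omega⟩) (by omega)
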